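/- arXiv:2410.21704 — 3 statements merged into one kernel-verified Lean document; each statement's English description precedes it below -/
import Mathlib

section
/- For Q-learning on a finite MDP under Assumption 9, the Markov chain {Y_k} = {(S_k, A_k)} admits a solution V_Q(y) to the Poisson equation V_Q(y) = F(Q,y) + E_y[V_Q(Y₁)] − F̄(Q), given explicitly by V_Q(y) = E_y[∑_{n=0}^{τ−1}(F(Q,Y_n) − F̄(Q))] where τ is the first return time to a fixed reference state y₀; this solution satisfies ‖V_{Q₁}(y) − V_{Q₂}(y)‖_∞ ≤ 4τ_{y₀}‖Q₁ − Q₂‖_∞ for all Q₁, Q₂ and y, where τ_{y₀} = max_y E_y[hitting time of y₀], and V_{Q*}(y) = 0 for all y. -/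
open Finset MeasureTheory

noncomputable section

/-- The Bellman optimality operator. -/
def bellQ {S A : Type*} [Fintype S] [Fintype A] [Nonempty A]
    (P : S → A → S → ℝ) (Rw : S → A → ℝ) (γ : ℝ) (Q : S × A → ℝ) : S × A → ℝ :=
  fun sa => Rw sa.1 sa.2 + γ * ∑ s' : S, P sa.1 sa.2 s' * ⨆ a' : A, Q (s', a')

/-- The asynchronous `Q`-learning operator. -/
def qF {S A : Type*} [Fintype S] [Fintype A] [Nonempty A] [DecidableEq S] [DecidableEq A]
    (P : S → A → S → ℝ) (Rw : S → A → ℝ) (γ : ℝ) (Q : S × A → ℝ) (y : S × A) :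
    S × A → ℝ :=
  fun sa => if sa = y then bellQ P Rw γ Q sa - Q sa else 0

/-- First hitting time (at a positive time) of the state `y₀` along the path `ω`
(junk value `0` if `y₀` is never hit). -/
def hitTime {Y : Type*} [DecidableEq Y] (y₀ : Y) (ω : ℕ → Y) : ℕ :=
  letI := Classical.dec (∃ n, 0 < n ∧ ω n = y₀)
  if h : ∃ n, 0 < n ∧ ω n = y₀ then Nat.find h else 0

/-- The transition matrix `p` with all transitions into `y₀` removed. -/
def tabooMatrix {X : Type*} [DecidableEq X] (p : X → X → ℝ) (y₀ : X) : Matrix X X ℝ :=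
  Matrix.of fun y z => if z = y₀ then 0 else p y z

/-- The paths that do not visit `y₀` at the times `1, …, n`. -/
def avoidSet {X : Type*} (y₀ : X) (n : ℕ) : Set (ℕ → X) :=
  {ω | ∀ i, 0 < i → i ≤ n → ω i ≠ y₀}

lemma tabooMatrix_apply_nonneg {X : Type*} [DecidableEq X] {p : X → X → ℝ} {y₀ : X}
    (hp : ∀ y z, 0 ≤ p y z) (y z : X) :
    0 ≤ tabooMatrix p y₀ y z := by
  simp only [tabooMatrix, Matrix.of_apply]
  split_ifs <;> simp [hp]

section TabooMatrix

variable {X : Type*} [Fintype X] [DecidableEq X] {p : X → X → ℝ} {y₀ : X}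

lemma tabooMatrix_pow_apply_nonneg (hp : ∀ y z, 0 ≤ p y z) (n : ℕ) (y z : X) :
    0 ≤ (tabooMatrix p y₀ ^ n) y z := by
  induction n generalizing y with
  | zero => simp only [pow_zero, Matrix.one_apply]; split_ifs <;> simp
  | succ n ih =>
    rw [pow_succ', Matrix.mul_apply]
    exact Finset.sum_nonneg fun w _ => mul_nonneg (tabooMatrix_apply_nonneg hp y w) (ih w)

lemma tabooMatrix_sum_le_one (hp : ∀ y z, 0 ≤ p y z) (hp1 : ∀ y, ∑ z, p y z = 1) (y : X) :
    ∑ z, tabooMatrix p y₀ y z ≤ 1 := by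
  rw [← hp1 y]
  refine Finset.sum_le_sum fun z _ => ?_
  simp only [tabooMatrix, Matrix.of_apply]
  split_ifs <;> simp [hp]

lemma tabooMatrix_rowSum_add (m n : ℕ) (y : X) :
    ∑ z, (tabooMatrix p y₀ ^ (m + n)) y z =
      ∑ w, (tabooMatrix p y₀ ^ m) y w * ∑ z, (tabooMatrix p y₀ ^ n) w z := by
  simp only [pow_add, Matrix.mul_apply, Finset.mul_sum]
  exact Finset.sum_comm

lemma tabooMatrix_rowSum_le_one (hp : ∀ y z, 0 ≤ p y z) (hp1 : ∀ y, ∑ z, p y z = 1)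
    (n : ℕ) (y : X) : ∑ z, (tabooMatrix p y₀ ^ n) y z ≤ 1 := by
  induction n generalizing y with
  | zero => simp [Matrix.one_apply]
  | succ n ih =>
    rw [add_comm, tabooMatrix_rowSum_add, pow_one]
    calc _ ≤ ∑ w, tabooMatrix p y₀ y w * 1 :=
          Finset.sum_le_sum fun w _ =>
            mul_le_mul_of_nonneg_left (ih w) (tabooMatrix_apply_nonneg hp y w)
      _ ≤ 1 := by simpa using tabooMatrix_sum_le_one hp hp1 y

lemma tabooMatrix_rowSum_antitone (hp : ∀ y z, 0 ≤ p y z) (hp1 : ∀ y, ∑ z, p y z = 1)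
    (y : X) : Antitone fun n => ∑ z, (tabooMatrix p y₀ ^ n) y z := by
  refine antitone_nat_of_succ_le fun n => ?_
  rw [tabooMatrix_rowSum_add]
  refine Finset.sum_le_sum fun w _ => ?_
  exact mul_le_of_le_one_right (tabooMatrix_pow_apply_nonneg hp n y w)
    (tabooMatrix_rowSum_le_one hp hp1 1 w)

/-- If, from every state, `y₀` can be reached in the sense that no nonempty set of states is closed
under the transitions and never leads to `y₀`, then the taboo row sums are eventually `< 1`. -/
lemma exists_tabooMatrix_rowSum_lt_one (hp : ∀ y z, 0 ≤ p y z) (hp1 : ∀ y, ∑ z, p y z = 1)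
    (hreach : ∀ D : X → Prop, (∀ y z, D y → p y z ≠ 0 → D z ∧ z ≠ y₀) → ∀ y, ¬ D y) (y : X) :
    ∃ n, ∑ z, (tabooMatrix p y₀ ^ n) y z < 1 := by
  by_contra! hcon
  refine hreach (fun y => ∀ n, 1 ≤ ∑ z, (tabooMatrix p y₀ ^ n) y z) (fun y z hy hz => ?_) y hcon
  have hle : ∀ n w, tabooMatrix p y₀ y w * ∑ z, (tabooMatrix p y₀ ^ n) w z ≤ p y w := by
    intro n w
    have h1 : tabooMatrix p y₀ y w ≤ p y w := by
      simp only [tabooMatrix, Matrix.of_apply]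
      split_ifs <;> simp [hp]
    exact (mul_le_of_le_one_right (tabooMatrix_apply_nonneg hp y w)
      (tabooMatrix_rowSum_le_one hp hp1 n w)).trans h1
  have heq : ∀ n w, tabooMatrix p y₀ y w * ∑ z, (tabooMatrix p y₀ ^ n) w z = p y w := by
    intro n w
    refine (Finset.sum_eq_sum_iff_of_le fun w _ => hle n w).1 ?_ w (Finset.mem_univ w)
    refine le_antisymm (Finset.sum_le_sum fun w _ => hle n w) ?_
    have := hy (1 + n)
    rw [tabooMatrix_rowSum_add, pow_one] at this
    rw [hp1]
    exact this
  have hz0 : z ≠ y₀ := by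
    rintro rfl
    have := heq 0 z
    simp [tabooMatrix] at this
    exact hz this.symm
  refine ⟨fun n => ?_, hz0⟩
  have := heq n z
  rw [tabooMatrix, Matrix.of_apply, if_neg hz0] at this
  exact (mul_right_eq_self₀.1 this |>.resolve_right hz).ge

lemma tabooMatrix_rowSum_summable (hp : ∀ y z, 0 ≤ p y z) (hp1 : ∀ y, ∑ z, p y z = 1)
    (hreach : ∀ D : X → Prop, (∀ y z, D y → p y z ≠ 0 → D z ∧ z ≠ y₀) → ∀ y, ¬ D y) (y : X) :
    Summable fun n => ∑ z, (tabooMatrix p y₀ ^ n) y z := by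
  classical
  set r : ℕ → X → ℝ := fun n y => ∑ z, (tabooMatrix p y₀ ^ n) y z with hr
  have hr0 : ∀ n y, 0 ≤ r n y := fun n y =>
    Finset.sum_nonneg fun z _ => tabooMatrix_pow_apply_nonneg hp n y z
  choose k hk using exists_tabooMatrix_rowSum_lt_one hp hp1 hreach
  set N := Finset.univ.sup k
  have hN : ∀ y, r N y < 1 := fun y =>
    (tabooMatrix_rowSum_antitone hp hp1 y (Finset.le_sup (Finset.mem_univ y))).trans_lt (hk y)
  obtain ⟨y₁, -, hy₁⟩ := Finset.exists_max_image Finset.univ (r N) ⟨y, Finset.mem_univ y⟩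
  set ρ := r N y₁
  have hρ : 0 < 1 - ρ := sub_pos.2 (hN y₁)
  have hbound : ∀ M y, ∑ n ∈ Finset.range M, r n y ≤ N / (1 - ρ) := by
    intro M
    obtain ⟨y₂, -, hy₂⟩ := Finset.exists_max_image Finset.univ
      (fun y => ∑ n ∈ Finset.range M, r n y) ⟨y, Finset.mem_univ y⟩
    set s := ∑ n ∈ Finset.range M, r n y₂
    have hs0 : 0 ≤ s := Finset.sum_nonneg fun n _ => hr0 n y₂
    have hs : s ≤ N + ρ * s := by
      calc s ≤ ∑ n ∈ Finset.range (N + M), r n y₂ :=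
            Finset.sum_le_sum_of_subset_of_nonneg
              (Finset.range_mono (Nat.le_add_left M N)) fun n _ _ => hr0 n y₂
        _ = ∑ n ∈ Finset.range N, r n y₂ +
              ∑ w, (tabooMatrix p y₀ ^ N) y₂ w * ∑ n ∈ Finset.range M, r n w := by
            rw [Finset.sum_range_add]
            congr 1
            simp only [hr, tabooMatrix_rowSum_add N, Finset.mul_sum (Finset.range M)]
            exact Finset.sum_comm
        _ ≤ N + ρ * s := by
            gcongr
            · calc _ ≤ ∑ n ∈ Finset.range N, (1 : ℝ) :=
                    Finset.sum_le_sum fun n _ => tabooMatrix_rowSum_le_one hp hp1 n y₂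
                _ = N := by simp
            · calc _ ≤ ∑ w, (tabooMatrix p y₀ ^ N) y₂ w * s :=
                    Finset.sum_le_sum fun w _ => mul_le_mul_of_nonneg_left
                      (hy₂ w (Finset.mem_univ w)) (tabooMatrix_pow_apply_nonneg hp N y₂ w)
                _ = r N y₂ * s := by rw [← Finset.sum_mul]
                _ ≤ ρ * s := mul_le_mul_of_nonneg_right (hy₁ y₂ (Finset.mem_univ y₂)) hs0
    intro y
    refine (hy₂ y (Finset.mem_univ y)).trans ?_
    rw [le_div_iff₀ hρ]
    linarith
  exact summable_of_sum_range_le (fun n => hr0 n y) fun M => hbound M y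

lemma tabooMatrix_series_eq_add {E : Type*} [NormedAddCommGroup E] [NormedSpace ℝ E]
    {f h : X → E} (hh : ∀ y, HasSum (fun n => ∑ z, (tabooMatrix p y₀ ^ n) y z • f z) (h y))
    (y : X) : h y = f y + ∑ w, tabooMatrix p y₀ y w • h w := by
  have hshift : HasSum (fun n => ∑ z, (tabooMatrix p y₀ ^ (n + 1)) y z • f z)
      (∑ w, tabooMatrix p y₀ y w • h w) := by
    have h := hasSum_sum fun w (_ : w ∈ Finset.univ) => (hh w).const_smul (tabooMatrix p y₀ y w)
    convert h using 1
    ext1 n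
    simp only [pow_succ', Matrix.mul_apply, Finset.sum_smul, Finset.smul_sum, smul_smul]
    exact Finset.sum_comm
  have h := (hasSum_nat_add_iff
    (f := fun n => ∑ z, (tabooMatrix p y₀ ^ n) y z • f z) 1).1 hshift
  rw [(hh y).unique h]
  simp [Matrix.one_apply, ite_smul, add_comm]

/-- Kac's cycle identity: integrating `h = f + K h`, with `K` the taboo matrix, against a
stationary vector. -/
lemma stationary_smul_eq_sum {E : Type*} [NormedAddCommGroup E] [NormedSpace ℝ E]
    {f h : X → E} (hh : ∀ y, h y = f y + ∑ w, tabooMatrix p y₀ y w • h w)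
    {m : X → ℝ} (hm : ∀ z, ∑ y, m y * p y z = m z) :
    m y₀ • h y₀ = ∑ y, m y • f y := by
  have key : ∀ y, h y + p y y₀ • h y₀ = f y + ∑ w, p y w • h w := by
    intro y
    have : ∑ w, p y w • h w = ∑ w, tabooMatrix p y₀ y w • h w + p y y₀ • h y₀ := by
      rw [← Finset.sum_erase_add _ _ (Finset.mem_univ y₀),
        ← Finset.sum_erase_add _ (fun w => tabooMatrix p y₀ y w • h w)
          (Finset.mem_univ y₀)]
      congr 1
      simp only [tabooMatrix, Matrix.of_apply, if_true, zero_smul, add_zero]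
      exact Finset.sum_congr rfl fun w hw => by rw [if_neg (Finset.ne_of_mem_erase hw)]
    rw [this, ← add_assoc, ← hh]
  have hsum : ∑ y, m y • (h y + p y y₀ • h y₀) = ∑ y, m y • (f y + ∑ w, p y w • h w) :=
    Finset.sum_congr rfl fun y _ => by rw [key]
  simp only [smul_add, Finset.sum_add_distrib, Finset.smul_sum, smul_smul] at hsum
  rw [Finset.sum_comm (f := fun y w => (m y * p y w) • h w)] at hsum
  simp only [← Finset.sum_smul, hm] at hsum
  rw [add_comm] at hsum
  exact add_right_cancel hsum

end TabooMatrix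

lemma lt_hitTime_iff {X : Type*} [DecidableEq X] {y₀ : X} {ω : ℕ → X} (h : ∃ n, 0 < n ∧ ω n = y₀) (n : ℕ) :
    n < hitTime y₀ ω ↔ ω ∈ avoidSet y₀ n := by
  classical
  rw [hitTime, dif_pos h, Nat.lt_find_iff]
  simp only [avoidSet, Set.mem_ofPred_eq, not_and]
  exact forall_congr' fun i => ⟨fun h a b => h b a, fun h a b => h b a⟩

lemma tsum_indicator_avoidSet {X E : Type*} [DecidableEq X] [NormedAddCommGroup E] {y₀ : X} (f : X → E)
    {ω : ℕ → X} (h : ∃ n, 0 < n ∧ ω n = y₀) :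
    ∑' n, (avoidSet y₀ n).indicator (fun ω => f (ω n)) ω =
      ∑ n ∈ Finset.range (hitTime y₀ ω), f (ω n) := by
  rw [tsum_eq_sum (s := Finset.range (hitTime y₀ ω))]
  · refine Finset.sum_congr rfl fun n hn => Set.indicator_of_mem ?_ _
    exact (lt_hitTime_iff h n).1 (Finset.mem_range.1 hn)
  · intro n hn
    refine Set.indicator_of_notMem (fun hω => hn ?_) _
    exact Finset.mem_range.2 ((lt_hitTime_iff h n).2 hω)

lemma indicator_avoidSet_eq_sum {X E : Type*} [Fintype X] [NormedAddCommGroup E] {y₀ : X}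
    (f : X → E) (n : ℕ) :
    (avoidSet y₀ n).indicator (fun ω => f (ω n)) =
      fun ω => ∑ z, ({ω | ω n = z} ∩ avoidSet y₀ n).indicator (fun _ => f z) ω := by
  classical
  ext1 ω
  rw [Finset.sum_eq_single (ω n)]
  · by_cases h : ω ∈ avoidSet y₀ n
    · rw [Set.indicator_of_mem h,
        Set.indicator_of_mem (show ω ∈ {ω' | ω' n = ω n} ∩ avoidSet y₀ n from ⟨rfl, h⟩)]
    · rw [Set.indicator_of_notMem h, Set.indicator_of_notMem fun h' => h h'.2]
  · exact fun z _ hz => Set.indicator_of_notMem (fun h => hz h.1.symm) _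
  · simp

section PathMeasure

variable {X : Type*} [Fintype X] [MeasurableSpace X] [MeasurableSingletonClass X]
  {p : X → X → ℝ} {y₀ y : X} {μ : Measure (ℕ → X)} [IsProbabilityMeasure μ]

lemma measurableSet_coord_eq (n : ℕ) (z : X) : MeasurableSet {ω : ℕ → X | ω n = z} :=
  measurableSet_eq_fun (measurable_pi_apply n) measurable_const

lemma measurableSet_avoidSet (n : ℕ) : MeasurableSet (avoidSet y₀ n) := by
  simp only [avoidSet, Set.ofPred_forall]
  exact .iInter fun i => .iInter fun _ => .iInter fun _ => (measurableSet_coord_eq i y₀).compl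

lemma measureReal_eq_sum_inter_coord (s : Set (ℕ → X)) (k : ℕ) :
    μ.real s = ∑ w, μ.real ({ω | ω k = w} ∩ s) := by
  have h := sum_measureReal_preimage_singleton (μ := μ.restrict s) (f := fun ω : ℕ → X => ω k)
    Finset.univ (fun w _ => measurableSet_coord_eq k w)
  rw [Finset.coe_univ, Set.preimage_univ, measureReal_restrict_apply_univ] at h
  rw [← h]
  refine Finset.sum_congr rfl fun w _ => ?_
  rw [measureReal_restrict_apply (measurable_pi_apply k (measurableSet_singleton w))]
  rfl

lemma integrable_indicator_avoidSet {E : Type*} [NormedAddCommGroup E] (f : X → E) (n : ℕ) :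
    Integrable ((avoidSet y₀ n).indicator fun ω => f (ω n)) μ := by
  rw [indicator_avoidSet_eq_sum]
  exact integrable_finsetSum _ fun z _ => (integrable_const _).indicator
    ((measurableSet_coord_eq n z).inter (measurableSet_avoidSet n))

variable [DecidableEq X]

lemma measureReal_cylinder_avoid (hp : ∀ y z, 0 ≤ p y z)
    (hlaw : ∀ (n : ℕ) (σ : ℕ → X), μ {ω | ∀ i ≤ n, ω i = σ i} =
      ENNReal.ofReal ((if σ 0 = y then (1 : ℝ) else 0) *
        ∏ i ∈ Finset.range n, p (σ i) (σ (i + 1))))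
    (n m : ℕ) (σ : ℕ → X) (z : X) :
    μ.real {ω | (∀ i ≤ m, ω i = σ i) ∧ (∀ i, m < i → i ≤ m + n → ω i ≠ y₀) ∧ ω (m + n) = z} =
      μ.real {ω | ∀ i ≤ m, ω i = σ i} * (tabooMatrix p y₀ ^ n) (σ m) z := by
  induction n generalizing m σ with
  | zero =>
    rw [pow_zero, Matrix.one_apply]
    split_ifs with h
    · rw [mul_one]
      congr 1
      ext ω
      refine ⟨fun hω => hω.1, fun hω => ⟨hω, fun i hi hi' => absurd hi' (by omega), ?_⟩⟩
      rw [add_zero, hω m le_rfl, h]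
    · rw [mul_zero]
      convert measureReal_empty
      ext ω
      simp only [Set.mem_ofPred_eq, Set.mem_empty_iff_false, iff_false]
      rintro ⟨h1, -, h2⟩
      exact h (by rw [← h1 m le_rfl]; simpa using h2)
  | succ n ih =>
    rw [measureReal_eq_sum_inter_coord _ (m + 1), pow_succ', Matrix.mul_apply, Finset.mul_sum]
    refine Finset.sum_congr rfl fun w _ => ?_
    by_cases hw : w = y₀
    · have h0 : tabooMatrix p y₀ (σ m) w = 0 := by simp [tabooMatrix, hw]
      rw [h0, zero_mul, mul_zero]
      convert measureReal_empty
      ext ω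
      simp only [Set.mem_inter_iff, Set.mem_ofPred_eq, Set.mem_empty_iff_false, iff_false]
      rintro ⟨h1, -, h2, -⟩
      exact h2 (m + 1) (by omega) (by omega) (h1.trans hw)
    · have h1 : tabooMatrix p y₀ (σ m) w = p (σ m) w := by simp [tabooMatrix, hw]
      set σ' := Function.update σ (m + 1) w with hσ'
      have hσ'm : σ' (m + 1) = w := by simp [hσ']
      have hσ'le : ∀ i ≤ m, σ' i = σ i := fun i hi =>
        Function.update_of_ne (by omega) _ _
      have hcyl : μ.real {ω | ∀ i ≤ m + 1, ω i = σ' i} =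
          μ.real {ω | ∀ i ≤ m, ω i = σ i} * p (σ m) w := by
        have hpos : ∀ (k : ℕ) (σ : ℕ → X), 0 ≤ (if σ 0 = y then (1 : ℝ) else 0) *
            ∏ i ∈ Finset.range k, p (σ i) (σ (i + 1)) := fun k σ =>
          mul_nonneg (by split_ifs <;> simp) (Finset.prod_nonneg fun i _ => hp _ _)
        rw [measureReal_def, measureReal_def, hlaw, hlaw, ENNReal.toReal_ofReal (hpos _ _),
          ENNReal.toReal_ofReal (hpos _ _), Finset.prod_range_succ, hσ'm, hσ'le m le_rfl,
          hσ'le 0 (Nat.zero_le m), ← mul_assoc]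
        congr 2
        refine Finset.prod_congr rfl fun i hi => ?_
        have := Finset.mem_range.1 hi
        rw [hσ'le i (by omega), hσ'le (i + 1) (by omega)]
      have := ih (m + 1) σ'
      rw [hcyl, hσ'm] at this
      rw [h1, ← mul_assoc, ← this]
      congr 1
      ext ω
      simp only [Set.mem_inter_iff, Set.mem_ofPred_eq]
      constructor
      · rintro ⟨h2, h3, h4, h5⟩
        refine ⟨fun i hi => ?_, fun i hi hi' => h4 i (by omega) (by omega), ?_⟩
        · rcases hi.lt_or_eq with hi | rfl
          · rw [hσ'le i (by omega), h3 i (by omega)]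
          · rw [hσ'm, h2]
        · rw [← h5]; congr 1; omega
      · rintro ⟨h2, h3, h4⟩
        refine ⟨by rw [h2 _ le_rfl, hσ'm], fun i hi => ?_, fun i hi hi' => ?_, ?_⟩
        · rw [h2 i (by omega), hσ'le i hi]
        · rcases (Nat.succ_le_of_lt hi).lt_or_eq with hi | rfl
          · exact h3 i hi (by omega)
          · rw [h2 _ le_rfl, hσ'm]; exact hw
        · rw [← h4]; congr 1; omega

lemma measureReal_coord_inter_avoidSet (hp : ∀ y z, 0 ≤ p y z)
    (hlaw : ∀ (n : ℕ) (σ : ℕ → X), μ {ω | ∀ i ≤ n, ω i = σ i} =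
      ENNReal.ofReal ((if σ 0 = y then (1 : ℝ) else 0) *
        ∏ i ∈ Finset.range n, p (σ i) (σ (i + 1))))
    (n : ℕ) (z : X) :
    μ.real ({ω | ω n = z} ∩ avoidSet y₀ n) = (tabooMatrix p y₀ ^ n) y z := by
  rw [measureReal_eq_sum_inter_coord _ 0, Finset.sum_eq_single y]
  · have h := measureReal_cylinder_avoid (y₀ := y₀) hp hlaw n 0 (fun _ => y) z
    have h1 : μ.real {ω | ∀ i ≤ 0, ω i = y} = 1 := by
      rw [measureReal_def, hlaw 0 fun _ => y]
      simp
    rw [h1, one_mul] at h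
    rw [← h]
    congr 1
    ext ω
    simp only [avoidSet, Set.mem_inter_iff, Set.mem_ofPred_eq, zero_add, nonpos_iff_eq_zero,
      forall_eq]
    tauto
  · intro w _ hw
    have h0 : μ.real {ω | ω 0 = w} = 0 := by
      have := hlaw 0 fun _ => w
      simp only [nonpos_iff_eq_zero, forall_eq, if_neg hw] at this
      rw [measureReal_def, this]
      simp
    exact le_antisymm (h0 ▸ measureReal_mono Set.inter_subset_left) measureReal_nonneg
  · simp

lemma integral_indicator_avoidSet {E : Type*} [NormedAddCommGroup E] [NormedSpace ℝ E]
    [CompleteSpace E] (hp : ∀ y z, 0 ≤ p y z)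
    (hlaw : ∀ (n : ℕ) (σ : ℕ → X), μ {ω | ∀ i ≤ n, ω i = σ i} =
      ENNReal.ofReal ((if σ 0 = y then (1 : ℝ) else 0) *
        ∏ i ∈ Finset.range n, p (σ i) (σ (i + 1))))
    (f : X → E) (n : ℕ) :
    ∫ ω, (avoidSet y₀ n).indicator (fun ω => f (ω n)) ω ∂μ =
      ∑ z, (tabooMatrix p y₀ ^ n) y z • f z := by
  have hms : ∀ z, MeasurableSet ({ω : ℕ → X | ω n = z} ∩ avoidSet y₀ n) := fun z =>
    (measurableSet_coord_eq n z).inter (measurableSet_avoidSet n)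
  rw [indicator_avoidSet_eq_sum, integral_finsetSum _ fun z _ =>
    (integrable_const (f z)).indicator (hms z)]
  refine Finset.sum_congr rfl fun z _ => ?_
  rw [integral_indicator_const _ (hms z), measureReal_coord_inter_avoidSet hp hlaw]

lemma ae_exists_hit (hp : ∀ y z, 0 ≤ p y z)
    (hlaw : ∀ (n : ℕ) (σ : ℕ → X), μ {ω | ∀ i ≤ n, ω i = σ i} =
      ENNReal.ofReal ((if σ 0 = y then (1 : ℝ) else 0) *
        ∏ i ∈ Finset.range n, p (σ i) (σ (i + 1))))
    (hsum : Summable fun n => ∑ z, (tabooMatrix p y₀ ^ n) y z) :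
    ∀ᵐ ω ∂μ, ∃ n, 0 < n ∧ ω n = y₀ := by
  rw [ae_iff, ← measureReal_eq_zero_iff]
  refine le_antisymm (ge_of_tendsto' hsum.tendsto_atTop_zero fun n => ?_) measureReal_nonneg
  calc μ.real {ω | ¬ ∃ n, 0 < n ∧ ω n = y₀} ≤ μ.real (avoidSet y₀ n) :=
        measureReal_mono fun ω hω i hi _ h => hω ⟨i, hi, h⟩
    _ = ∑ z, (tabooMatrix p y₀ ^ n) y z := by
        rw [measureReal_eq_sum_inter_coord _ n]
        exact Finset.sum_congr rfl fun z _ => measureReal_coord_inter_avoidSet hp hlaw n z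

/-- The expected additive functional up to the first visit of `y₀` at a positive time is the series
of the powers of the taboo matrix. -/
lemma hasSum_integral_sum_range_hitTime {E : Type*} [NormedAddCommGroup E] [NormedSpace ℝ E]
    [CompleteSpace E] (hp : ∀ y z, 0 ≤ p y z)
    (hlaw : ∀ (n : ℕ) (σ : ℕ → X), μ {ω | ∀ i ≤ n, ω i = σ i} =
      ENNReal.ofReal ((if σ 0 = y then (1 : ℝ) else 0) *
        ∏ i ∈ Finset.range n, p (σ i) (σ (i + 1))))
    (hsum : Summable fun n => ∑ z, (tabooMatrix p y₀ ^ n) y z) (f : X → E) :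
    HasSum (fun n => ∑ z, (tabooMatrix p y₀ ^ n) y z • f z)
      (∫ ω, ∑ n ∈ Finset.range (hitTime y₀ ω), f (ω n) ∂μ) := by
  have hnorm : ∀ n, ∫ ω, ‖(avoidSet y₀ n).indicator (fun ω => f (ω n)) ω‖ ∂μ =
      ∑ z, (tabooMatrix p y₀ ^ n) y z * ‖f z‖ := by
    intro n
    simp only [norm_indicator_eq_indicator_norm]
    exact integral_indicator_avoidSet hp hlaw (fun z => ‖f z‖) n
  have hsumm : Summable fun n => ∫ ω, ‖(avoidSet y₀ n).indicator (fun ω => f (ω n)) ω‖ ∂μ := by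
    simp only [hnorm]
    refine Summable.of_nonneg_of_le (fun n => Finset.sum_nonneg fun z _ => mul_nonneg
      (tabooMatrix_pow_apply_nonneg hp n y z) (norm_nonneg _)) (fun n => ?_)
      (hsum.mul_right (∑ x, ‖f x‖))
    rw [Finset.sum_mul]
    exact Finset.sum_le_sum fun z _ => mul_le_mul_of_nonneg_left
      (Finset.single_le_sum (f := fun x => ‖f x‖) (fun x _ => norm_nonneg _) (Finset.mem_univ z))
      (tabooMatrix_pow_apply_nonneg hp n y z)
  have h := hasSum_integral_of_summable_integral_norm
    (fun n => integrable_indicator_avoidSet (μ := μ) (y₀ := y₀) f n) hsumm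
  simp only [integral_indicator_avoidSet hp hlaw] at h
  convert h using 1
  refine integral_congr_ae ?_
  filter_upwards [ae_exists_hit hp hlaw hsum] with ω hω
  exact (tsum_indicator_avoidSet f hω).symm

end PathMeasure

section Bellman

variable {S A : Type*} [Fintype S] [Fintype A] [Nonempty A] {P : S → A → S → ℝ}
  {Rw : S → A → ℝ} {γ : ℝ}

lemma abs_ciSup_sub_ciSup_le {f g : A → ℝ} {C : ℝ} (h : ∀ a, |f a - g a| ≤ C) :
    |(⨆ a, f a) - ⨆ a, g a| ≤ C := by
  have hf := Set.finite_range f |>.bddAbove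
  have hg := Set.finite_range g |>.bddAbove
  rw [abs_sub_le_iff]
  constructor
  · rw [sub_le_iff_le_add]
    exact ciSup_le fun a => by linarith [le_ciSup hg a, (abs_sub_le_iff.1 (h a)).1]
  · rw [sub_le_iff_le_add]
    exact ciSup_le fun a => by linarith [le_ciSup hf a, (abs_sub_le_iff.1 (h a)).2]

lemma abs_bellQ_sub_bellQ_le (hγ : 0 ≤ γ) (hP0 : ∀ s a s', 0 ≤ P s a s')
    (hP1 : ∀ s a, ∑ s', P s a s' = 1) (Q₁ Q₂ : S × A → ℝ) (y : S × A) :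
    |bellQ P Rw γ Q₁ y - bellQ P Rw γ Q₂ y| ≤ γ * ‖Q₁ - Q₂‖ := by
  have h : bellQ P Rw γ Q₁ y - bellQ P Rw γ Q₂ y =
      γ * ∑ s', P y.1 y.2 s' * ((⨆ a, Q₁ (s', a)) - ⨆ a, Q₂ (s', a)) := by
    simp only [bellQ, mul_sub, Finset.sum_sub_distrib]
    ring
  rw [h, abs_mul, abs_of_nonneg hγ]
  refine mul_le_mul_of_nonneg_left ((Finset.abs_sum_le_sum_abs _ _).trans ?_) hγ
  calc _ ≤ ∑ s', P y.1 y.2 s' * ‖Q₁ - Q₂‖ := by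
        refine Finset.sum_le_sum fun s' _ => ?_
        rw [abs_mul, abs_of_nonneg (hP0 _ _ _)]
        exact mul_le_mul_of_nonneg_left
          (abs_ciSup_sub_ciSup_le fun a => norm_le_pi_norm (Q₁ - Q₂) (s', a)) (hP0 _ _ _)
    _ = ‖Q₁ - Q₂‖ := by rw [← Finset.sum_mul, hP1, one_mul]

lemma norm_qF_sub_qF_le [DecidableEq S] [DecidableEq A] (hγ : γ ∈ Set.Ioo (0 : ℝ) 1)
    (hP0 : ∀ s a s', 0 ≤ P s a s') (hP1 : ∀ s a, ∑ s', P s a s' = 1)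
    (Q₁ Q₂ : S × A → ℝ) (y : S × A) :
    ‖qF P Rw γ Q₁ y - qF P Rw γ Q₂ y‖ ≤ 2 * ‖Q₁ - Q₂‖ := by
  have h0 := norm_nonneg (Q₁ - Q₂)
  refine (pi_norm_le_iff_of_nonneg (by positivity)).2 fun z => ?_
  simp only [Pi.sub_apply, qF]
  split_ifs
  · have h1 := abs_bellQ_sub_bellQ_le (Rw := Rw) hγ.1.le hP0 hP1 Q₁ Q₂ z
    have h2 : |Q₁ z - Q₂ z| ≤ ‖Q₁ - Q₂‖ := norm_le_pi_norm (Q₁ - Q₂) z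
    have h3 : γ * ‖Q₁ - Q₂‖ ≤ ‖Q₁ - Q₂‖ := mul_le_of_le_one_left h0 hγ.2.le
    rw [sub_sub_sub_comm, Real.norm_eq_abs]
    exact (abs_sub _ _).trans (by linarith)
  · simp

lemma qF_eq_zero_of_bellQ_eq [DecidableEq S] [DecidableEq A] {Q : S × A → ℝ}
    (hQ : bellQ P Rw γ Q = Q) (y : S × A) : qF P Rw γ Q y = 0 := by
  ext z
  simp [qF, hQ]

end Bellman

/-- Irreducibility of the state chain, together with full support of the policy, forbids sets of
state-action pairs that are closed under the transitions and avoid `y₀`. -/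
lemma not_mem_of_closed_avoiding {S A : Type*} [Fintype S] [Fintype A] [DecidableEq S]
    {P : S → A → S → ℝ} {π : S → A → ℝ} {Pb : S → S → ℝ}
    (hP1 : ∀ s a, ∑ s', P s a s' = 1) (hπ : ∀ s a, 0 < π s a)
    (hPb : ∀ s s', Pb s s' = ∑ a, π s a * P s a s')
    (hirr : ∀ s s', ∃ n : ℕ, 0 < ((Matrix.of Pb) ^ n) s s')
    {p : S × A → S × A → ℝ} (hp : ∀ y y' : S × A, p y y' = P y.1 y.2 y'.1 * π y'.1 y'.2)
    {y₀ : S × A} {D : S × A → Prop} (hD : ∀ y z, D y → p y z ≠ 0 → D z ∧ z ≠ y₀)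
    (y : S × A) : ¬ D y := by
  intro hy
  have hstep : ∀ (y : S × A) s, D y → P y.1 y.2 s ≠ 0 → ∀ a, D (s, a) ∧ (s, a) ≠ y₀ :=
    fun y s hy hs a => hD y (s, a) hy (by rw [hp]; exact mul_ne_zero hs (hπ s a).ne')
  have hpow : ∀ n s s', (∀ a, D (s, a) ∧ (s, a) ≠ y₀) → ((Matrix.of Pb) ^ n) s s' ≠ 0 →
      ∀ a, D (s', a) ∧ (s', a) ≠ y₀ := by
    intro n
    induction n with
    | zero =>
      intro s s' hs h
      rw [pow_zero, Matrix.one_apply] at h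
      obtain rfl : s = s' := by simpa using h
      exact hs
    | succ n ih =>
      intro s s' hs h
      rw [pow_succ, Matrix.mul_apply] at h
      obtain ⟨k, -, hk⟩ := Finset.exists_ne_zero_of_sum_ne_zero h
      have hk' := right_ne_zero_of_mul hk
      rw [Matrix.of_apply, hPb] at hk'
      obtain ⟨a, -, ha⟩ := Finset.exists_ne_zero_of_sum_ne_zero hk'
      exact hstep (k, a) s' (ih s k hs (left_ne_zero_of_mul hk) a).1 (right_ne_zero_of_mul ha)
  obtain ⟨s, -, hs⟩ := Finset.exists_ne_zero_of_sum_ne_zero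
    ((hP1 y.1 y.2).trans_ne one_ne_zero)
  obtain ⟨n, hn⟩ := hirr s y₀.1
  exact (hpow n s y₀.1 (hstep y s hy hs) hn.ne' y₀.2).2 rfl

/-- Proposition 5.1(b): for `Q`-learning under Assumption 9, the explicit function
`V_Q(y) = E_y[∑_{n<τ}(F(Q,Y_n) − F̄(Q))]` solves the Poisson equation, is
`4τ_{y₀}`-Lipschitz in `Q` (in `‖·‖_∞`), and vanishes at `Q*`. -/
theorem q_learning_poisson_solution
    {S A : Type*} [Fintype S] [Fintype A] [Nonempty S] [Nonempty A]
    [DecidableEq S] [DecidableEq A]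
    [MeasurableSpace S] [MeasurableSingletonClass S]
    [MeasurableSpace A] [MeasurableSingletonClass A]
    (P : S → A → S → ℝ) (Rw : S → A → ℝ) (γ : ℝ) (hγ : γ ∈ Set.Ioo (0 : ℝ) 1)
    (hP0 : ∀ s a s', 0 ≤ P s a s') (hP1 : ∀ s a, ∑ s', P s a s' = 1)
    (Qstar : S × A → ℝ) (hQstar : bellQ P Rw γ Qstar = Qstar)
    -- Assumption 9
    (πb : S → A → ℝ) (hπb : ∀ s a, 0 < πb s a) (hπb1 : ∀ s, ∑ a, πb s a = 1)
    (Pb : S → S → ℝ) (hPb : ∀ s s', Pb s s' = ∑ a, πb s a * P s a s')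
    (hirr : ∀ s s', ∃ n : ℕ, 0 < ((Matrix.of Pb) ^ n) s s')
    (μb : S → ℝ) (hμb0 : ∀ s, 0 ≤ μb s) (hμb1 : ∑ s, μb s = 1)
    (hμbinv : ∀ s', ∑ s, μb s * Pb s s' = μb s')
    -- the transition kernel of the state-action chain {Y_k}
    (PbQ : S × A → S × A → ℝ)
    (hPbQ : ∀ y y' : S × A, PbQ y y' = P y.1 y.2 y'.1 * πb y'.1 y'.2)
    -- the canonical path measures of the chain started at each state
    (Pry : S × A → Measure (ℕ → S × A)) (hprob : ∀ y, IsProbabilityMeasure (Pry y))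
    (hlaw : ∀ (y : S × A) (n : ℕ) (σ : ℕ → S × A),
      Pry y {ω | ∀ i ≤ n, ω i = σ i} =
        ENNReal.ofReal ((if σ 0 = y then (1 : ℝ) else 0) *
          ∏ i ∈ Finset.range n, PbQ (σ i) (σ (i + 1))))
    -- the fixed reference state y₀ and the maximal expected hitting time τ_{y₀}
    (y₀ : S × A) (τmax : ℝ)
    (hτ : IsGreatest {t : ℝ | ∃ y : S × A, t = ∫ ω, (hitTime y₀ ω : ℝ) ∂(Pry y)} τmax) :
    ∃ VQ : (S × A → ℝ) → S × A → (S × A → ℝ),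
      -- VQ is given explicitly by V_Q(y) = E_y[∑_{n<τ}(F(Q,Y_n) − F̄(Q))]
      (∀ (Q : S × A → ℝ) (y : S × A),
        VQ Q y = ∫ ω, (∑ n ∈ Finset.range (hitTime y₀ ω),
          (qF P Rw γ Q (ω n) -
            ∑ y' : S × A, (μb y'.1 * πb y'.1 y'.2) • qF P Rw γ Q y')) ∂(Pry y)) ∧
      -- VQ solves the Poisson equation V_Q(y) = F(Q,y) + E_y[V_Q(Y₁)] − F̄(Q)
      (∀ (Q : S × A → ℝ) (y : S × A),
        VQ Q y = qF P Rw γ Q y + (∑ y' : S × A, PbQ y y' • VQ Q y') -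
          ∑ y' : S × A, (μb y'.1 * πb y'.1 y'.2) • qF P Rw γ Q y') ∧
      -- Lipschitz bound ‖V_{Q₁}(y) − V_{Q₂}(y)‖_∞ ≤ 4 τ_{y₀} ‖Q₁ − Q₂‖_∞
      (∀ (Q₁ Q₂ : S × A → ℝ) (y : S × A),
        ‖VQ Q₁ y - VQ Q₂ y‖ ≤ 4 * τmax * ‖Q₁ - Q₂‖) ∧
      -- and V_{Q*} ≡ 0
      (∀ y : S × A, VQ Qstar y = 0) := by
  have hp : ∀ y z, 0 ≤ PbQ y z := fun y z => by
    rw [hPbQ]; exact mul_nonneg (hP0 _ _ _) (hπb _ _).le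
  have hp1 : ∀ y, ∑ z, PbQ y z = 1 := fun y => by
    simp only [hPbQ, Fintype.sum_prod_type, ← Finset.mul_sum, hπb1, mul_one, hP1]
  have hsum := tabooMatrix_rowSum_summable hp hp1 (y₀ := y₀) fun D hD y =>
    not_mem_of_closed_avoiding hP1 hπb hPb hirr hPbQ hD y
  set m : S × A → ℝ := fun y => μb y.1 * πb y.1 y.2 with hm
  have hm0 : ∀ y, 0 ≤ m y := fun y => mul_nonneg (hμb0 _) (hπb _ _).le
  have hm1 : ∑ y, m y = 1 := by
    simp only [hm, Fintype.sum_prod_type, ← Finset.mul_sum, hπb1, mul_one, hμb1]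
  have hminv : ∀ z, ∑ y, m y * PbQ y z = m z := fun z => by
    simp only [hm, hPbQ, Fintype.sum_prod_type]
    rw [← hμbinv z.1, Finset.sum_mul]
    refine Finset.sum_congr rfl fun s _ => ?_
    rw [hPb, Finset.mul_sum, Finset.sum_mul]
    exact Finset.sum_congr rfl fun a _ => by ring
  have hHit : ∀ y, HasSum (fun n => ∑ z, (tabooMatrix PbQ y₀ ^ n) y z)
      (∫ ω, (hitTime y₀ ω : ℝ) ∂(Pry y)) := fun y => by
    have := hprob y
    simpa using hasSum_integral_sum_range_hitTime hp (hlaw y) (hsum y) fun _ => (1 : ℝ)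
  have hmy₀ : m y₀ ≠ 0 := by
    have h := stationary_smul_eq_sum (f := fun _ => (1 : ℝ))
      (tabooMatrix_series_eq_add fun y => by simpa using hHit y) hminv
    intro h0
    simp [h0, hm1] at h
  set Fbar : (S × A → ℝ) → S × A → ℝ := fun Q => ∑ y', m y' • qF P Rw γ Q y' with hFbar
  have hV : ∀ Q y, HasSum
      (fun n => ∑ z, (tabooMatrix PbQ y₀ ^ n) y z • (qF P Rw γ Q z - Fbar Q))
      (∫ ω, ∑ n ∈ Finset.range (hitTime y₀ ω), (qF P Rw γ Q (ω n) - Fbar Q) ∂(Pry y)) :=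
    fun Q y => by
      have := hprob y
      exact hasSum_integral_sum_range_hitTime hp (hlaw y) (hsum y)
        fun z => qF P Rw γ Q z - Fbar Q
  refine ⟨fun Q y => ∫ ω, ∑ n ∈ Finset.range (hitTime y₀ ω),
    (qF P Rw γ Q (ω n) - Fbar Q) ∂(Pry y), fun Q y => rfl, fun Q y => ?_,
    fun Q₁ Q₂ y => ?_, fun y => ?_⟩
  · set V : S × A → S × A → ℝ := fun y => ∫ ω, ∑ n ∈ Finset.range (hitTime y₀ ω),
      (qF P Rw γ Q (ω n) - Fbar Q) ∂(Pry y)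
    have hrec := tabooMatrix_series_eq_add (hV Q)
    have hV0 : V y₀ = 0 := by
      have hmean : ∑ y, m y • (qF P Rw γ Q y - Fbar Q) = 0 := by
        simp only [smul_sub, Finset.sum_sub_distrib, ← Finset.sum_smul, hm1, one_smul]
        exact sub_self _
      exact (smul_eq_zero.1 ((stationary_smul_eq_sum hrec hminv).trans hmean)).resolve_left hmy₀
    have htaboo : ∑ w, tabooMatrix PbQ y₀ y w • V w = ∑ w, PbQ y w • V w := by
      refine Finset.sum_congr rfl fun w _ => ?_
      by_cases hw : w = y₀
      · rw [hw, hV0, smul_zero, smul_zero]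
      · rw [tabooMatrix, Matrix.of_apply, if_neg hw]
    change V y = qF P Rw γ Q y + ∑ y', PbQ y y' • V y' - Fbar Q
    rw [← htaboo, add_sub_right_comm]
    exact hrec y
  · have hF : ∀ z, ‖qF P Rw γ Q₁ z - qF P Rw γ Q₂ z‖ ≤ 2 * ‖Q₁ - Q₂‖ :=
      norm_qF_sub_qF_le hγ hP0 hP1 Q₁ Q₂
    have hFb : ‖Fbar Q₁ - Fbar Q₂‖ ≤ 2 * ‖Q₁ - Q₂‖ := by
      simp only [hFbar, ← Finset.sum_sub_distrib, ← smul_sub]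
      calc _ ≤ ∑ z, m z * (2 * ‖Q₁ - Q₂‖) := norm_sum_le_of_le _ fun z _ => by
            rw [norm_smul, Real.norm_of_nonneg (hm0 z)]
            exact mul_le_mul_of_nonneg_left (hF z) (hm0 z)
        _ = 2 * ‖Q₁ - Q₂‖ := by rw [← Finset.sum_mul, hm1, one_mul]
    have hbound := ((hV Q₁ y).sub (hV Q₂ y)).norm_le_of_bounded
      ((hHit y).mul_right (4 * ‖Q₁ - Q₂‖)) fun n => by
        rw [← Finset.sum_sub_distrib, Finset.sum_mul]
        refine norm_sum_le_of_le _ fun z _ => ?_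
        have hK := tabooMatrix_pow_apply_nonneg (y₀ := y₀) hp n y z
        rw [← smul_sub, norm_smul, Real.norm_of_nonneg hK, sub_sub_sub_comm]
        exact mul_le_mul_of_nonneg_left
          ((norm_sub_le _ _).trans (by linarith [hF z])) hK
    have hle : ∫ ω, (hitTime y₀ ω : ℝ) ∂(Pry y) ≤ τmax := hτ.2 ⟨y, rfl⟩
    calc _ ≤ _ := hbound
      _ ≤ τmax * (4 * ‖Q₁ - Q₂‖) := by gcongr
      _ = 4 * τmax * ‖Q₁ - Q₂‖ := by ring
  · simp [hFbar, qF_eq_zero_of_bellQ_eq hQstar]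

end
end

section
/- Let P be the transition kernel of an irreducible Markov chain on a countable state space 𝒮 = {s₁, s₂, …} (indexed so that P(s_{i+1}|s_i) > 0 for all i) with stationary distribution μ, let Ψ be the infinite feature matrix (row i equal to ψ(s_i)ᵀ ∈ ℝ^d) with linearly independent columns satisfying ∑_i μ(s_i)ψ_j²(s_i) ≤ ψ̂² < ∞, and let Λ = diag(μ). Then for every nonzero θ in E_Ψ^⊥, one has θᵀΨᵀΛ(I − P)Ψθ > 0; equivalently, (1/2)∑_i μ(s_i)∑_{s}P(s|s_i)(𝒱(s_i) − 𝒱(s))² > 0 where 𝒱(s) = ψ(s)ᵀθ. -/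
open RealInnerProductSpace

noncomputable section

/-- `n`-step transition probabilities of a countable-state transition kernel. -/
def kerPow {S : Type*} [DecidableEq S] (P : S → S → ℝ) : ℕ → S → S → ℝ
  | 0 => fun s s' => if s' = s then 1 else 0
  | n + 1 => fun s s' => ∑' t, kerPow P n s t * P t s'

/-- The subspace `E_Ψ`. -/
def EPsiSub {S : Type*} {d : ℕ} (ψ : S → EuclideanSpace ℝ (Fin d)) :
    Submodule ℝ (EuclideanSpace ℝ (Fin d)) :=
  Submodule.span ℝ {θ | ∀ s, ⟪ψ s, θ⟫ = 1}

theorem kerPow_nonneg {S : Type*} [DecidableEq S] {P : S → S → ℝ} (hP0 : ∀ i j, 0 ≤ P i j)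
    (n : ℕ) (i j : S) : 0 ≤ kerPow P n i j := by
  induction n generalizing j with
  | zero => simp only [kerPow]; split_ifs <;> norm_num
  | succ n ih => exact tsum_nonneg fun t => mul_nonneg (ih t) (hP0 t j)

/-- Mass of an invariant measure propagates along positive-probability transitions. -/
theorem invariant_pos_of_step {S : Type*} {P : S → S → ℝ} {μ : S → ℝ}
    (hP0 : ∀ i j, 0 ≤ P i j) (hμ0 : ∀ i, 0 ≤ μ i)
    (hμinv : ∀ j, HasSum (fun i => μ i * P i j) (μ j)) {i j : S}
    (hi : 0 < μ i) (hij : 0 < P i j) : 0 < μ j :=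
  (mul_pos hi hij).trans_le <|
    le_hasSum (hμinv j) i fun t _ => mul_nonneg (hμ0 t) (hP0 t j)

theorem invariant_pos_of_kerPow_pos {S : Type*} [DecidableEq S] {P : S → S → ℝ} {μ : S → ℝ}
    (hP0 : ∀ i j, 0 ≤ P i j) (hμ0 : ∀ i, 0 ≤ μ i)
    (hμinv : ∀ j, HasSum (fun i => μ i * P i j) (μ j)) {i : S} (hi : 0 < μ i)
    (n : ℕ) {j : S} (hij : 0 < kerPow P n i j) : 0 < μ j := by
  induction n generalizing j with
  | zero =>
    simp only [kerPow] at hij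
    split_ifs at hij with h
    · rwa [h]
    · exact absurd hij (lt_irrefl _)
  | succ n ih =>
    obtain ⟨t, ht⟩ : ∃ t, kerPow P n i t * P t j ≠ 0 := by
      by_contra! h
      simp only [kerPow, h, tsum_zero, lt_self_iff_false] at hij
    have hk := (kerPow_nonneg hP0 n i t).lt_of_ne' (left_ne_zero_of_mul ht)
    have hp := (hP0 t j).lt_of_ne' (right_ne_zero_of_mul ht)
    exact invariant_pos_of_step hP0 hμ0 hμinv (ih hk) hp

/-- An irreducible chain charges every state under its stationary distribution. -/
theorem stationary_pos {S : Type*} [DecidableEq S] {P : S → S → ℝ} {μ : S → ℝ}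
    (hP0 : ∀ i j, 0 ≤ P i j) (hirr : ∀ i j, ∃ n, 0 < kerPow P n i j)
    (hμ0 : ∀ i, 0 ≤ μ i) (hμ1 : HasSum μ 1)
    (hμinv : ∀ j, HasSum (fun i => μ i * P i j) (μ j)) (j : S) : 0 < μ j := by
  obtain ⟨i, hi⟩ : ∃ i, μ i ≠ 0 := by
    by_contra! h
    obtain rfl : μ = 0 := funext h
    exact zero_ne_one (hasSum_zero.unique hμ1)
  obtain ⟨n, hn⟩ := hirr i j
  exact invariant_pos_of_kerPow_pos hP0 hμ0 hμinv ((hμ0 i).lt_of_ne' hi) n hn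

/-- A feature combination with parameter in `E_Ψᗮ` that is constant has zero parameter. -/
theorem eq_zero_of_mem_EPsiSub_orthogonal_of_const {S : Type*} {d : ℕ}
    {ψ : S → EuclideanSpace ℝ (Fin d)}
    (hlin : LinearIndependent ℝ (fun j : Fin d => fun i : S => ψ i j))
    {θ : EuclideanSpace ℝ (Fin d)} (hθ : θ ∈ (EPsiSub ψ)ᗮ) {c : ℝ}
    (hc : ∀ i, ⟪ψ i, θ⟫ = c) : θ = 0 := by
  by_cases h0 : c = 0
  · have hz := Fintype.linearIndependent_iff.1 hlin (fun j => θ j) (by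
      ext i
      have := hc i
      simpa [PiLp.inner_apply, h0] using this)
    ext j
    exact hz j
  · have hmem : c⁻¹ • θ ∈ EPsiSub ψ :=
      Submodule.subset_span fun s => by rw [real_inner_smul_right, hc s, inv_mul_cancel₀ h0]
    have hmem' : θ ∈ EPsiSub ψ := by
      simpa [smul_smul, mul_inv_cancel₀ h0] using (EPsiSub ψ).smul_mem c hmem
    exact inner_self_eq_zero.1 (hθ θ hmem')

theorem summable_mul_inner_sq {S : Type*} {d : ℕ} {μ : S → ℝ} (hμ0 : ∀ i, 0 ≤ μ i)
    {ψ : S → EuclideanSpace ℝ (Fin d)}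
    (hψsum : ∀ j : Fin d, Summable fun i => μ i * (ψ i j) ^ 2)
    (θ : EuclideanSpace ℝ (Fin d)) : Summable fun i => μ i * ⟪ψ i, θ⟫ ^ 2 := by
  have hnorm : Summable fun i => (∑ j, μ i * (ψ i j) ^ 2) * ‖θ‖ ^ 2 :=
    (summable_sum fun j _ => hψsum j).mul_right _
  refine hnorm.of_nonneg_of_le (fun i => mul_nonneg (hμ0 i) (sq_nonneg _)) fun i => ?_
  rw [← Finset.mul_sum, ← EuclideanSpace.real_norm_sq_eq, mul_assoc, ← mul_pow]
  refine mul_le_mul_of_nonneg_left ?_ (hμ0 i)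
  exact sq_le_sq' (abs_le.1 (abs_real_inner_le_norm _ _)).1 (real_inner_le_norm _ _)

section DirichletForm

variable {S : Type*} {P : S → S → ℝ} {μ V : S → ℝ}

theorem hasSum_transition_sq_left (hP0 : ∀ i j, 0 ≤ P i j) (hP1 : ∀ i, HasSum (P i) 1)
    (hμ0 : ∀ i, 0 ≤ μ i) (hV : Summable fun i => μ i * V i ^ 2) :
    HasSum (fun p : S × S => μ p.1 * P p.1 p.2 * V p.1 ^ 2) (∑' i, μ i * V i ^ 2) := by
  have hrow (i : S) : HasSum (fun s => μ i * P i s * V i ^ 2) (μ i * V i ^ 2) := by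
    simpa using ((hP1 i).mul_left (μ i)).mul_right (V i ^ 2)
  have hsum : Summable fun p : S × S => μ p.1 * P p.1 p.2 * V p.1 ^ 2 :=
    (summable_prod_of_nonneg fun p =>
      mul_nonneg (mul_nonneg (hμ0 _) (hP0 _ _)) (sq_nonneg _)).2
      ⟨fun i => (hrow i).summable, hV.congr fun i => (hrow i).tsum_eq.symm⟩
  exact (hsum.hasSum.prod_fiberwise hrow).tsum_eq ▸ hsum.hasSum

theorem hasSum_transition_sq_right (hP0 : ∀ i j, 0 ≤ P i j) (hμ0 : ∀ i, 0 ≤ μ i)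
    (hμinv : ∀ j, HasSum (fun i => μ i * P i j) (μ j))
    (hV : Summable fun i => μ i * V i ^ 2) :
    HasSum (fun p : S × S => μ p.1 * P p.1 p.2 * V p.2 ^ 2) (∑' i, μ i * V i ^ 2) := by
  have hcol (s : S) : HasSum (fun i => μ i * P i s * V s ^ 2) (μ s * V s ^ 2) :=
    (hμinv s).mul_right (V s ^ 2)
  have hsum : Summable fun p : S × S => μ p.2 * P p.2 p.1 * V p.1 ^ 2 :=
    (summable_prod_of_nonneg fun p =>
      mul_nonneg (mul_nonneg (hμ0 _) (hP0 _ _)) (sq_nonneg _)).2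
      ⟨fun s => (hcol s).summable, hV.congr fun s => (hcol s).tsum_eq.symm⟩
  have h := (hsum.hasSum.prod_fiberwise hcol).tsum_eq ▸ hsum.hasSum
  exact (Equiv.prodComm S S).hasSum_iff.1 h

theorem summable_transition_mul (hP0 : ∀ i j, 0 ≤ P i j) (hP1 : ∀ i, HasSum (P i) 1)
    (hμ0 : ∀ i, 0 ≤ μ i) (hμinv : ∀ j, HasSum (fun i => μ i * P i j) (μ j))
    (hV : Summable fun i => μ i * V i ^ 2) :
    Summable fun p : S × S => μ p.1 * P p.1 p.2 * (V p.1 * V p.2) := by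
  refine ((hasSum_transition_sq_left hP0 hP1 hμ0 hV).add
    (hasSum_transition_sq_right hP0 hμ0 hμinv hV)).summable.of_norm_bounded fun p => ?_
  have hw : 0 ≤ μ p.1 * P p.1 p.2 := mul_nonneg (hμ0 _) (hP0 _ _)
  rw [Real.norm_eq_abs, abs_mul, abs_of_nonneg hw, ← mul_add]
  refine mul_le_mul_of_nonneg_left (abs_le.2 ⟨?_, ?_⟩) hw
  · nlinarith [sq_nonneg (V p.1 + V p.2), sq_nonneg (V p.1), sq_nonneg (V p.2)]
  · nlinarith [sq_nonneg (V p.1 - V p.2), sq_nonneg (V p.1), sq_nonneg (V p.2)]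

theorem hasSum_transition_sub_sq (hP0 : ∀ i j, 0 ≤ P i j) (hP1 : ∀ i, HasSum (P i) 1)
    (hμ0 : ∀ i, 0 ≤ μ i) (hμinv : ∀ j, HasSum (fun i => μ i * P i j) (μ j))
    (hV : Summable fun i => μ i * V i ^ 2) :
    HasSum (fun p : S × S => μ p.1 * P p.1 p.2 * (V p.1 - V p.2) ^ 2)
      (2 * (∑' i, μ i * V i ^ 2 - ∑' p : S × S, μ p.1 * P p.1 p.2 * (V p.1 * V p.2))) := by
  rw [mul_sub, two_mul]
  have h := ((hasSum_transition_sq_left hP0 hP1 hμ0 hV).add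
    (hasSum_transition_sq_right hP0 hμ0 hμinv hV)).sub
    ((summable_transition_mul hP0 hP1 hμ0 hμinv hV).hasSum.mul_left 2)
  refine (congrArg (HasSum · _) (funext fun p => ?_)).mpr h
  ring

theorem tsum_mul_tsum_transition_sub_sq (hP0 : ∀ i j, 0 ≤ P i j)
    (hP1 : ∀ i, HasSum (P i) 1) (hμ0 : ∀ i, 0 ≤ μ i)
    (hμinv : ∀ j, HasSum (fun i => μ i * P i j) (μ j))
    (hV : Summable fun i => μ i * V i ^ 2) :
    ∑' i, μ i * ∑' s, P i s * (V i - V s) ^ 2 =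
      ∑' p : S × S, μ p.1 * P p.1 p.2 * (V p.1 - V p.2) ^ 2 := by
  rw [(hasSum_transition_sub_sq hP0 hP1 hμ0 hμinv hV).summable.tsum_prod]
  simp only [← tsum_mul_left, mul_assoc]

/-- The Dirichlet form as a double sum of squared increments. -/
theorem half_tsum_transition_sub_sq (hP0 : ∀ i j, 0 ≤ P i j) (hP1 : ∀ i, HasSum (P i) 1)
    (hμ0 : ∀ i, 0 ≤ μ i) (hμinv : ∀ j, HasSum (fun i => μ i * P i j) (μ j))
    (hV : Summable fun i => μ i * V i ^ 2) :
    (1 / 2) * ∑' i, μ i * ∑' s, P i s * (V i - V s) ^ 2 =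
      ∑' i, μ i * (V i ^ 2 - V i * ∑' s, P i s * V s) := by
  have hmul := summable_transition_mul hP0 hP1 hμ0 hμinv hV
  have hsub := hasSum_transition_sub_sq hP0 hP1 hμ0 hμinv hV
  have hrow (i : S) : ∑' s, μ i * P i s * (V i * V s) = μ i * (V i * ∑' s, P i s * V s) := by
    rw [← tsum_mul_left, ← tsum_mul_left]
    exact tsum_congr fun s => by ring
  have hcross := hmul.prod
  simp only [hrow] at hcross
  simp_rw [mul_sub]
  rw [hV.tsum_sub hcross, ← tsum_congr hrow, ← hmul.tsum_prod,
    tsum_mul_tsum_transition_sub_sq hP0 hP1 hμ0 hμinv hV, hsub.tsum_eq]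
  ring

/-- The Dirichlet form is positive as soon as one charged transition changes the value. -/
theorem tsum_transition_sub_sq_pos (hP0 : ∀ i j, 0 ≤ P i j) (hP1 : ∀ i, HasSum (P i) 1)
    (hμ0 : ∀ i, 0 ≤ μ i) (hμinv : ∀ j, HasSum (fun i => μ i * P i j) (μ j))
    (hV : Summable fun i => μ i * V i ^ 2) {i j : S} (hi : 0 < μ i) (hij : 0 < P i j)
    (hne : V i ≠ V j) : 0 < ∑' i, μ i * ∑' s, P i s * (V i - V s) ^ 2 := by
  have hsub := (hasSum_transition_sub_sq hP0 hP1 hμ0 hμinv hV).summable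
  rw [tsum_mul_tsum_transition_sub_sq hP0 hP1 hμ0 hμinv hV]
  exact hsub.tsum_pos (fun p => mul_nonneg (mul_nonneg (hμ0 _) (hP0 _ _)) (sq_nonneg _)) (i, j)
    (mul_pos (mul_pos hi hij) (sq_pos_of_ne_zero (sub_ne_zero.2 hne)))

end DirichletForm

/-- Lemma B.7: for an irreducible countable-state Markov chain with stationary
distribution `μ` and linearly independent, `Λ`-square-integrable features `ψ`, the
Dirichlet form of `𝒱 = Ψθ` is strictly positive for every nonzero `θ ∈ E_Ψ^⊥`:
`θᵀΨᵀΛ(I − P)Ψθ > 0`. -/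
theorem dirichlet_form_positive
    {d : ℕ}
    -- the chain, on the countable state space {s₁, s₂, …} ≃ ℕ
    (P : ℕ → ℕ → ℝ) (hP0 : ∀ i j, 0 ≤ P i j) (hP1 : ∀ i, HasSum (P i) 1)
    -- the indexing is such that P(s_{i+1} | s_i) > 0
    (hidx : ∀ i, 0 < P i (i + 1))
    -- irreducibility
    (hirr : ∀ i j, ∃ n, 0 < kerPow P n i j)
    -- stationary distribution μ
    (μ : ℕ → ℝ) (hμ0 : ∀ i, 0 ≤ μ i) (hμ1 : HasSum μ 1)
    (hμinv : ∀ j, HasSum (fun i => μ i * P i j) (μ j))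
    -- features with linearly independent columns and bounded Λ-norm
    (ψ : ℕ → EuclideanSpace ℝ (Fin d))
    (hlin : LinearIndependent ℝ (fun j : Fin d => fun i : ℕ => ψ i j))
    (ψhat : ℝ) (hψsum : ∀ j : Fin d, Summable fun i => μ i * (ψ i j) ^ 2)
    (hψ : ∀ j : Fin d, ∑' i, μ i * (ψ i j) ^ 2 ≤ ψhat ^ 2) :
    ∀ θ : EuclideanSpace ℝ (Fin d), θ ∈ (EPsiSub ψ)ᗮ → θ ≠ 0 →
      (0 < ∑' i, μ i * ((⟪ψ i, θ⟫) ^ 2 - ⟪ψ i, θ⟫ * ∑' s, P i s * ⟪ψ s, θ⟫)) ∧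
      (0 < (1 / 2) * ∑' i, μ i * ∑' s, P i s * (⟪ψ i, θ⟫ - ⟪ψ s, θ⟫) ^ 2) := by
  intro θ hθ hθ0
  have hV := summable_mul_inner_sq hμ0 hψsum θ
  obtain ⟨i, hi⟩ : ∃ i, ⟪ψ i, θ⟫ ≠ ⟪ψ (i + 1), θ⟫ := by
    by_contra! h
    refine hθ0 (eq_zero_of_mem_EPsiSub_orthogonal_of_const hlin hθ (c := ⟪ψ 0, θ⟫) fun i => ?_)
    induction i with
    | zero => rfl
    | succ n ih => rw [← h n, ih]
  have hpos := tsum_transition_sub_sq_pos hP0 hP1 hμ0 hμinv hV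
    (stationary_pos hP0 hirr hμ0 hμ1 hμinv i) (hidx i) hi
  rw [← half_tsum_transition_sub_sq hP0 hP1 hμ0 hμinv hV]
  exact ⟨by positivity, by positivity⟩

end
end

section
/- Consider the birth–death Markov chain on the countable state space 𝒮 = {s₀, s₁, s₂, …} with transition probabilities P(s_{i+1}|s_i) = p and P(s_{i−1}|s_i) = 1−p for i ≥ 1, P(s₁|s₀) = p and P(s₀|s₀) = 1−p, where p < 1/2, whose unique stationary distribution is μ(s_i) = (1−2p)p^i/(1−p)^{i+1}, and let Λ = diag(μ). Then over the set of functions V : 𝒮 → ℝ with ∑_s V(s) = 0 and ∑_s V²(s) = 1, the infimum of VᵀΛ(I − P)V equals 0; in particular, there is no uniform spectral-gap constant Δ > 0 with VᵀΛ(I − P)V ≥ Δ on this set. (Witness: the functions V_j with V_j(s_j) = 1/√2, V_j(s_{j+1}) = −1/√2, and 0 elsewhere satisfy V_jᵀΛ(I − P)V_j → 0 as j → ∞.) -/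
open Filter

noncomputable section

/-- The birth–death chain on `ℕ` with up-probability `p` and down-probability `1 − p`
(with a self-loop of probability `1 − p` at state `0`). -/
def bdKernel (p : ℝ) : ℕ → ℕ → ℝ :=
  fun i j =>
    if j = i + 1 then p
    else if j + 1 = i then 1 - p
    else if i = 0 ∧ j = 0 then 1 - p
    else 0

/-- The stationary distribution `μ(s_i) = (1−2p)pⁱ/(1−p)^{i+1}` of the birth–death chain. -/
def bdStationary (p : ℝ) : ℕ → ℝ :=
  fun i => (1 - 2 * p) * p ^ i / (1 - p) ^ (i + 1)

/-- The Dirichlet form `VᵀΛ(I − P)V = ∑_i μ(s_i)(V²(s_i) − V(s_i)∑_s P(s|s_i)V(s))`. -/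
def bdDirichlet (p : ℝ) (V : ℕ → ℝ) : ℝ :=
  ∑' i, bdStationary p i * ((V i) ^ 2 - V i * ∑' j, bdKernel p i j * V j)

/-- The witness functions `V_j` with `V_j(s_j) = 1/√2`, `V_j(s_{j+1}) = −1/√2`,
and `0` elsewhere. -/
def bdWitness (j : ℕ) : ℕ → ℝ :=
  fun i => if i = j then 1 / Real.sqrt 2 else if i = j + 1 then -(1 / Real.sqrt 2) else 0

theorem tsum_bdKernel_mul (p : ℝ) (V : ℕ → ℝ) (i : ℕ) :
    ∑' j, bdKernel p i j * V j = p * V (i + 1) + (1 - p) * V (i - 1) := by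
  rw [tsum_eq_sum (s := {i + 1, i - 1})]
  · rw [Finset.sum_pair (by omega)]
    rcases i with _ | i
    · simp [bdKernel]
    · simp [bdKernel, show i ≠ i + 1 + 1 by omega]
  · intro j hj
    simp only [Finset.mem_insert, Finset.mem_singleton, not_or] at hj
    have h₁ : ¬ j + 1 = i := by omega
    have h₂ : ¬ (i = 0 ∧ j = 0) := by omega
    simp [bdKernel, hj.1, h₁, h₂]

theorem bdStationary_detailed_balance {p : ℝ} (hp : p < 1) (i : ℕ) :
    bdStationary p (i + 1) * (1 - p) = bdStationary p i * p := by
  have h : 1 - p ≠ 0 := by linarith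
  simp only [bdStationary]
  field_simp
  ring

theorem bdStationary_nonneg {p : ℝ} (hp : 0 < p) (hp' : p < 1 / 2) (i : ℕ) :
    0 ≤ bdStationary p i := by
  have h₁ : 0 < 1 - 2 * p := by linarith
  have h₂ : 0 < 1 - p := by linarith
  unfold bdStationary
  positivity

theorem tendsto_bdStationary {p : ℝ} (hp : 0 < p) (hp' : p < 1 / 2) :
    Tendsto (bdStationary p) atTop (nhds 0) := by
  have h : 0 < 1 - p := by linarith
  have hr : Tendsto (fun i : ℕ => (p / (1 - p)) ^ i) atTop (nhds 0) :=
    tendsto_pow_atTop_nhds_zero_of_lt_one (by positivity)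
      (by rw [div_lt_one h]; linarith)
  have := hr.const_mul ((1 - 2 * p) / (1 - p))
  rw [mul_zero] at this
  refine this.congr fun i => ?_
  simp only [bdStationary, div_pow]
  field_simp
  ring

/-- Summation by parts for the partial sums of the Dirichlet form. -/
theorem sum_range_bdDirichlet_eq {p : ℝ} (hp : p < 1) (V : ℕ → ℝ) (n : ℕ) :
    ∑ i ∈ Finset.range (n + 1),
        bdStationary p i * ((V i) ^ 2 - V i * ∑' j, bdKernel p i j * V j) =
      ∑ i ∈ Finset.range n, bdStationary p i * p * (V i - V (i + 1)) ^ 2 +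
        bdStationary p n * p * ((V n - V (n + 1)) * V n) := by
  simp only [tsum_bdKernel_mul]
  induction n with
  | zero => simp; ring
  | succ n ih =>
    rw [Finset.sum_range_succ, ih, Finset.sum_range_succ]
    simp only [Nat.add_sub_cancel]
    linear_combination (V (n + 1) ^ 2 - V (n + 1) * V n) * bdStationary_detailed_balance hp n

theorem bdDirichlet_nonneg {p : ℝ} (hp : 0 < p) (hp' : p < 1 / 2) {V : ℕ → ℝ}
    (hV : Tendsto V atTop (nhds 0)) : 0 ≤ bdDirichlet p V := by
  unfold bdDirichlet
  by_cases hs : Summable fun i =>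
      bdStationary p i * ((V i) ^ 2 - V i * ∑' j, bdKernel p i j * V j)
  · have hlim := hs.hasSum.tendsto_sum_nat.comp (tendsto_add_atTop_nat 1)
    have hV' : Tendsto (fun n => V (n + 1)) atTop (nhds 0) :=
      hV.comp (tendsto_add_atTop_nat 1)
    have hbd : Tendsto (fun n => bdStationary p n * p * ((V n - V (n + 1)) * V n))
        atTop (nhds 0) := by
      simpa using ((tendsto_bdStationary hp hp').mul_const p).mul ((hV.sub hV').mul hV)
    refine le_of_tendsto_of_tendsto' hbd hlim fun n => ?_
    simp only [Function.comp_apply]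
    rw [sum_range_bdDirichlet_eq (by linarith)]
    refine le_add_of_nonneg_left (Finset.sum_nonneg fun i _ => ?_)
    have := bdStationary_nonneg hp hp' i
    positivity
  · rw [tsum_eq_zero_of_not_summable hs]

theorem hasSum_bdWitness (j : ℕ) : HasSum (bdWitness j) 0 := by
  have h : HasSum (bdWitness j) (∑ i ∈ {j, j + 1}, bdWitness j i) :=
    hasSum_sum_of_ne_finset_zero fun i hi => by
      simp only [Finset.mem_insert, Finset.mem_singleton, not_or] at hi
      simp [bdWitness, hi.1, hi.2]
  rw [Finset.sum_pair (by omega)] at h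
  simpa [bdWitness] using h

theorem hasSum_bdWitness_sq (j : ℕ) : HasSum (fun i => (bdWitness j i) ^ 2) 1 := by
  have h : HasSum (fun i => (bdWitness j i) ^ 2) (∑ i ∈ {j, j + 1}, (bdWitness j i) ^ 2) :=
    hasSum_sum_of_ne_finset_zero fun i hi => by
      simp only [Finset.mem_insert, Finset.mem_singleton, not_or] at hi
      simp [bdWitness, hi.1, hi.2]
  rw [Finset.sum_pair (by omega)] at h
  convert h using 1
  simp [bdWitness]
  norm_num

theorem bdDirichlet_bdWitness_succ (p : ℝ) (j : ℕ) :
    bdDirichlet p (bdWitness (j + 1)) =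
      bdStationary p (j + 1) * ((1 + p) / 2) + bdStationary p (j + 2) * ((2 - p) / 2) := by
  have hsq : (√2)⁻¹ * (√2)⁻¹ = (1 / 2 : ℝ) := by
    rw [← mul_inv, Real.mul_self_sqrt (by norm_num)]; norm_num
  simp only [bdDirichlet, tsum_bdKernel_mul]
  rw [tsum_eq_sum (s := {j + 1, j + 2})]
  · rw [Finset.sum_pair (by omega)]
    simp only [bdWitness, Nat.add_sub_cancel, show j + 2 - 1 = j + 1 by omega]
    simp [show j ≠ j + 1 + 1 by omega]
    linear_combination (bdStationary p (j + 1) * p + bdStationary p (j + 2) * (1 - p)) * hsq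
  · intro i hi
    simp only [Finset.mem_insert, Finset.mem_singleton, not_or] at hi
    simp [bdWitness, hi.1, hi.2]

theorem tendsto_bdDirichlet_bdWitness {p : ℝ} (hp : 0 < p) (hp' : p < 1 / 2) :
    Tendsto (fun j => bdDirichlet p (bdWitness j)) atTop (nhds 0) := by
  rw [← tendsto_add_atTop_iff_nat 1]
  simp only [bdDirichlet_bdWitness_succ]
  have h := tendsto_bdStationary hp hp'
  simpa using ((h.comp (tendsto_add_atTop_nat 1)).mul_const ((1 + p) / 2)).add
    ((h.comp (tendsto_add_atTop_nat 2)).mul_const ((2 - p) / 2))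

/-- Appendix B.5: on the positive-recurrent birth–death chain with `p < 1/2`, the
infimum of the Dirichlet form `VᵀΛ(I − P)V` over mean-zero, unit-`ℓ₂`-norm functions
is `0`; in particular there is no uniform spectral gap `Δ > 0`, as witnessed by the
functions `V_j`. -/
theorem birth_death_no_uniform_spectral_gap
    (p : ℝ) (hp : 0 < p) (hp' : p < 1 / 2) :
    IsGLB {x : ℝ | ∃ V : ℕ → ℝ, HasSum V 0 ∧ HasSum (fun i => (V i) ^ 2) 1 ∧
      x = bdDirichlet p V} 0 ∧
    (¬∃ Δ : ℝ, 0 < Δ ∧ ∀ V : ℕ → ℝ, HasSum V 0 → HasSum (fun i => (V i) ^ 2) 1 →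
      Δ ≤ bdDirichlet p V) ∧
    (∀ j, HasSum (bdWitness j) 0 ∧ HasSum (fun i => (bdWitness j i) ^ 2) 1) ∧
    Tendsto (fun j => bdDirichlet p (bdWitness j)) atTop (nhds 0) := by
  have hlim := tendsto_bdDirichlet_bdWitness hp hp'
  have hglb : IsGLB {x : ℝ | ∃ V : ℕ → ℝ, HasSum V 0 ∧ HasSum (fun i => (V i) ^ 2) 1 ∧
      x = bdDirichlet p V} 0 := by
    refine ⟨?_, fun b hb => ge_of_tendsto' hlim fun j =>
      hb ⟨_, hasSum_bdWitness j, hasSum_bdWitness_sq j, rfl⟩⟩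
    rintro _ ⟨V, hV, -, rfl⟩
    exact bdDirichlet_nonneg hp hp' hV.summable.tendsto_atTop_zero
  refine ⟨hglb, ?_, fun j => ⟨hasSum_bdWitness j, hasSum_bdWitness_sq j⟩, hlim⟩
  rintro ⟨Δ, hΔ, h⟩
  refine hΔ.not_ge (hglb.2 ?_)
  rintro _ ⟨V, hV, hV', rfl⟩
  exact h V hV hV'

end
end
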